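/- Suppose all n players use protocol Q. If the number of pending players at the start of interval I_{k+1} is at most n_{k+1}, then with probability at least 1 − exp(−n_{k+1}/3) (for all sufficiently large n), every player has successfully transmitted by the end of interval I_{k+1}. -/

import Mathlib

open scoped ENNReal

namespace Contention

/-- An acknowledgment-based protocol: maps a player's personal transmission history
(the list of her own past transmission indicators, oldest slot first) to the
probability of transmitting in the next slot. -/
abbrev Protocol : Type := List Bool → ℝ

/-- A protocol is valid if it always prescribes a probability in `[0,1]`. -/
def ValidProtocol (f : Protocol) : Prop := ∀ h : List Bool, 0 ≤ f h ∧ f h ≤ 1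

/-- A joint transmission history: the list of transmission vectors, oldest slot first. -/
abbrev Hist (n : ℕ) : Type := List (Fin n → Bool)

/-- The personal transmission history of player `i` extracted from a joint history. -/
def personal {n : ℕ} (h : Hist n) (i : Fin n) : List Bool := h.map fun v => v i

/-- Player `i` transmits alone (hence successfully) in the slot with transmission vector `v`. -/
def alone {n : ℕ} (v : Fin n → Bool) (i : Fin n) : Prop :=
  v i = true ∧ ∀ j : Fin n, j ≠ i → v j = false

instance {n : ℕ} (v : Fin n → Bool) (i : Fin n) : Decidable (alone v i) := by
  unfold alone; infer_instance

/-- Player `i` is still pending after joint history `h` (she never transmitted alone). -/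
def pending {n : ℕ} (h : Hist n) (i : Fin n) : Prop := ∀ v ∈ h, ¬ alone v i

instance {n : ℕ} (h : Hist n) (i : Fin n) : Decidable (pending h i) := by
  unfold pending; infer_instance

/-- Probability that the next slot has transmission vector `v`, given joint history `h`:
each pending player transmits independently with the probability her protocol assigns to
her personal history, and players that already succeeded stay quiet. -/
noncomputable def stepProb {n : ℕ} (F : Fin n → Protocol) (h : Hist n) (v : Fin n → Bool) : ℝ :=
  ∏ i : Fin n,
    if pending h i then
      (if v i = true then F i (personal h i) else 1 - F i (personal h i))
    else
      (if v i = true then 0 else 1)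

/-- Probability that, starting after joint history `h`, the next `e.length` slots produce
exactly the extension `e`. -/
noncomputable def contProb {n : ℕ} (F : Fin n → Protocol) (h e : Hist n) : ℝ :=
  ∏ t ∈ Finset.range e.length, stepProb F (h ++ e.take t) (e.getD t fun _ => false)

/-- Probability that the first `h.length` slots produce exactly the joint history `h`. -/
noncomputable def histProb {n : ℕ} (F : Fin n → Protocol) (h : Hist n) : ℝ := contProb F [] h

/-- Conditional probability, given joint history `h`, that player `i` is still pending
after `s` further slots. -/
noncomputable def condPendProb {n : ℕ} (F : Fin n → Protocol) (h : Hist n) (i : Fin n)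
    (s : ℕ) : ℝ :=
  ∑ e : Fin s → Fin n → Bool,
    if pending (h ++ List.ofFn e) i then contProb F h (List.ofFn e) else 0

/-- Conditional expected latency `E[Tᵢ | h]` of player `i` given joint history `h`
(`Tᵢ` is the first slot in which `i` transmits alone), computed via
`E[Tᵢ | h] = ∑_{s ≥ 0} Pr(Tᵢ > s | h)`; for `s ≤ h.length` the event `Tᵢ > s` is
determined by `h`, and for larger `s` its probability is `condPendProb`. -/
noncomputable def condLatency {n : ℕ} (F : Fin n → Protocol) (h : Hist n) (i : Fin n) : ℝ≥0∞ :=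
  ∑' s : ℕ,
    if s ≤ h.length then (if pending (h.take s) i then 1 else 0)
    else ENNReal.ofReal (condPendProb F h i (s - h.length))

/-- Conditional expected number of further slots until player `i` succeeds, given joint
history `h` (the slot of the successful transmission itself is counted). -/
noncomputable def condRemaining {n : ℕ} (F : Fin n → Protocol) (h : Hist n) (i : Fin n) : ℝ≥0∞ :=
  ∑' s : ℕ, ENNReal.ofReal (condPendProb F h i s)

/-- A profile of protocols is in equilibrium if after no joint history (arising with
positive probability) can a player strictly decrease her conditional expected latency
by unilaterally switching to another (valid) protocol. -/
def IsEquilibrium {n : ℕ} (F : Fin n → Protocol) : Prop :=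
  ∀ i : Fin n, ∀ h : Hist n, 0 < histProb F h →
    ∀ g : Protocol, ValidProtocol g →
      condLatency F h i ≤ condLatency (Function.update F i g) h i

end Contention

namespace Contention

/-- An age-based protocol: the transmission probability in slot `t` (that is, after a
personal history of length `t − 1`) is `p t`, depending only on the time `t ≥ 1`. -/
def ageProtocol (p : ℕ → ℝ) : Protocol := fun h => p (h.length + 1)

end Contention

namespace Contention

/-- `nj β n j = βʲ·n`, the target number of pending players for interval `Iⱼ`. -/
noncomputable def nj (β : ℝ) (n : ℕ) (j : ℕ) : ℝ := β ^ j * n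

/-- The length `ℓⱼ` of interval `Iⱼ`: `⌊(e/β)·nⱼ⌋` for `j ≤ k`, and `n` for `j = k+1`. -/
noncomputable def intervalLen (β : ℝ) (n k : ℕ) (j : ℕ) : ℕ :=
  if j ≤ k then ⌊(Real.exp 1 / β) * nj β n j⌋₊ else n

/-- The total length `ℓ₁ + ⋯ + ℓⱼ` of the first `j` intervals, so interval `Iⱼ` consists
of the slots `t` with `cumLen (j-1) < t ≤ cumLen j`. -/
noncomputable def cumLen (β : ℝ) (n k : ℕ) (j : ℕ) : ℕ :=
  ∑ j' ∈ Finset.Icc 1 j, intervalLen β n k j'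

/-- The deadline `t₀ = 1 + ℓ₁ + ⋯ + ℓ_{k+1}` of protocol `Q`. -/
noncomputable def deadline (β : ℝ) (n k : ℕ) : ℕ := 1 + cumLen β n k (k + 1)

/-- `QSpec β n k p` says that the age-based sequence `p` is the protocol `Q`: it transmits
with probability `1/nⱼ` in every slot of interval `Iⱼ` (for `j = 1, …, k+1`) and with
probability `1` in every slot `t ≥ t₀`. -/
def QSpec (β : ℝ) (n k : ℕ) (p : ℕ → ℝ) : Prop :=
  (∀ j : ℕ, 1 ≤ j → j ≤ k + 1 →
    ∀ t : ℕ, cumLen β n k (j - 1) < t → t ≤ cumLen β n k j → p t = 1 / nj β n j) ∧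
  (∀ t : ℕ, deadline β n k ≤ t → p t = 1)

/-- The number of pending players after joint history `h`. -/
def pendCount {n : ℕ} (h : Hist n) : ℕ := (Finset.univ.filter fun i : Fin n => pending h i).card

open Classical in
/-- The conditional probability, given joint history `h`, that the joint history after `s`
further slots satisfies property `P`. -/
noncomputable def condEvProb {n : ℕ} (F : Fin n → Protocol) (h : Hist n) (s : ℕ)
    (P : Hist n → Prop) : ℝ :=
  ∑ e : Fin s → Fin n → Bool,
    if P (h ++ List.ofFn e) then contProb F h (List.ofFn e) else 0

end Contention

namespace Contention

lemma contProb_cons {n : ℕ} (F : Fin n → Protocol) (h : Hist n) (v : Fin n → Bool) (e : Hist n) :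
    contProb F h (v :: e) = stepProb F h v * contProb F (h ++ [v]) e := by
  unfold contProb
  rw [List.length_cons, Finset.prod_range_succ', mul_comm]
  simp

lemma condEvProb_succ {n : ℕ} (F : Fin n → Protocol) (h : Hist n) (s : ℕ) (P : Hist n → Prop) :
    condEvProb F h (s + 1) P = ∑ v, stepProb F h v * condEvProb F (h ++ [v]) s P := by
  classical
  unfold condEvProb
  rw [← (Fin.consEquiv (fun _ : Fin (s + 1) => Fin n → Bool)).sum_comp, Fintype.sum_prod_type]
  refine Finset.sum_congr rfl fun v _ => ?_
  rw [Finset.mul_sum]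
  refine Finset.sum_congr rfl fun e _ => ?_
  have : List.ofFn ((Fin.consEquiv (fun _ : Fin (s + 1) => Fin n → Bool)) (v, e))
      = v :: List.ofFn e := by
    simp [Fin.consEquiv, List.ofFn_succ]
  rw [this, contProb_cons]
  simp [mul_ite]

lemma stepProb_sum {n : ℕ} (F : Fin n → Protocol) (h : Hist n) :
    ∑ v, stepProb F h v = 1 := by
  unfold stepProb
  have := Fintype.prod_sum (fun (i : Fin n) (b : Bool) =>
    if pending h i then
      (if b = true then F i (personal h i) else 1 - F i (personal h i))
    else (if b = true then (0 : ℝ) else 1))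
  rw [← this]
  refine Finset.prod_eq_one fun i _ => ?_
  by_cases hp : pending h i <;> simp [hp]

lemma pending_append {n : ℕ} (h : Hist n) (v : Fin n → Bool) (i : Fin n) :
    pending (h ++ [v]) i ↔ pending h i ∧ ¬ alone v i := by
  unfold pending
  simp [or_imp, forall_and]

lemma pendCount_append {n : ℕ} (h : Hist n) (v : Fin n → Bool) :
    (pendCount (h ++ [v]) : ℝ)
      = pendCount h - ∑ i with pending h i, if alone v i then (1 : ℝ) else 0 := by
  have h1 : (pendCount (h ++ [v]) : ℝ)
      = ∑ i with pending h i, if alone v i then (0 : ℝ) else 1 := by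
    unfold pendCount
    rw [Finset.card_eq_sum_ones, Finset.sum_filter, Finset.sum_filter]
    push_cast
    refine Finset.sum_congr rfl fun i _ => ?_
    by_cases a : pending h i <;> by_cases b : alone v i <;> simp [pending_append, a, b]
  have h2 : (pendCount h : ℝ) = ∑ i with pending h i, (1 : ℝ) := by
    simp [pendCount]
  rw [h1, h2, ← Finset.sum_sub_distrib]
  refine Finset.sum_congr rfl fun i _ => ?_
  split_ifs <;> simp

lemma pendCount_append_le {n : ℕ} (h : Hist n) (v : Fin n → Bool) :
    pendCount (h ++ [v]) ≤ pendCount h := by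
  unfold pendCount
  refine Finset.card_le_card fun i => ?_
  simp only [Finset.mem_filter, Finset.mem_univ, true_and, pending_append]
  exact fun a => a.1

lemma stepProb_age {n : ℕ} (p : ℕ → ℝ) (h : Hist n) (v : Fin n → Bool) :
    stepProb (fun _ : Fin n => ageProtocol p) h v = ∏ i : Fin n,
      if pending h i then (if v i = true then p (h.length + 1) else 1 - p (h.length + 1))
      else (if v i = true then 0 else 1) := by
  simp [stepProb, ageProtocol, personal]

lemma stepProb_nonneg {n : ℕ} (p : ℕ → ℝ) (h : Hist n) (v : Fin n → Bool)
    (h0 : 0 ≤ p (h.length + 1)) (h1 : p (h.length + 1) ≤ 1) :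
    0 ≤ stepProb (fun _ : Fin n => ageProtocol p) h v := by
  rw [stepProb_age]
  refine Finset.prod_nonneg fun i _ => ?_
  split_ifs <;> linarith

lemma stepProb_single {n : ℕ} (p : ℕ → ℝ) (h : Hist n) (i : Fin n) (hi : pending h i) :
    stepProb (fun _ : Fin n => ageProtocol p) h (fun j => decide (j = i))
      = p (h.length + 1) * (1 - p (h.length + 1)) ^ (pendCount h - 1) := by
  rw [stepProb_age, ← Finset.mul_prod_erase _ _ (Finset.mem_univ i)]
  congr 1
  · simp [hi]
  have : ∀ j ∈ Finset.univ.erase i, (if pending h j then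
      (if decide (j = i) = true then p (h.length + 1) else 1 - p (h.length + 1))
      else (if decide (j = i) = true then 0 else 1))
      = if pending h j then 1 - p (h.length + 1) else 1 := by
    intro j hj
    have : j ≠ i := Finset.ne_of_mem_erase hj
    simp [this]
  rw [Finset.prod_congr rfl this, ← Finset.prod_filter, Finset.prod_const]
  congr 1
  rw [Finset.filter_erase, Finset.card_erase_of_mem (by simp [hi])]
  rfl

lemma sum_alone {n : ℕ} (F : Fin n → Protocol) (h : Hist n) (i : Fin n) :
    ∑ v, stepProb F h v * (if alone v i then (1 : ℝ) else 0)
      = stepProb F h (fun j => decide (j = i)) := by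
  rw [Finset.sum_eq_single (fun j => decide (j = i))]
  · simp [alone]
  · intro v _ hv
    have : ¬ alone v i := by
      rintro ⟨a, b⟩
      apply hv
      funext j
      by_cases hj : j = i
      · subst hj; simp [a]
      · simp [hj, b j hj]
    simp [this]
  · simp

lemma success_bound {m : ℝ} (hm : 1 < m) (r : ℕ) (hr1 : 1 ≤ r) (hr : (r : ℝ) ≤ m) :
    1 / (Real.exp 1 * m) ≤ 1 / m * (1 - 1 / m) ^ (r - 1) := by
  have hm1 : 0 < m - 1 := by linarith
  have key : (1 + 1 / (m - 1)) ^ (r - 1) ≤ Real.exp 1 := by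
    calc (1 + 1 / (m - 1)) ^ (r - 1) ≤ (Real.exp (1 / (m - 1))) ^ (r - 1) := by
          gcongr
          linarith [Real.add_one_le_exp (1 / (m - 1))]
      _ = Real.exp (((r - 1 : ℕ) : ℝ) * (1 / (m - 1))) := by rw [Real.exp_nat_mul]
      _ ≤ Real.exp 1 := by
          apply Real.exp_le_exp.mpr
          rw [mul_one_div, div_le_one hm1, Nat.cast_sub hr1]
          push_cast
          linarith
  have e : 1 - 1 / m = (1 + 1 / (m - 1))⁻¹ := by
    have : m ≠ 0 := by linarith
    have : m - 1 ≠ 0 := by linarith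
    have h3 : 1 + 1 / (m - 1) = m / (m - 1) := by field_simp; ring
    rw [h3, inv_div]
    field_simp
  have hpos : 0 < (1 + 1 / (m - 1)) ^ (r - 1) := by positivity
  rw [e, inv_pow, mul_comm (Real.exp 1), ← one_div_mul_one_div, one_div (Real.exp 1)]
  have : 0 < m := by linarith
  gcongr

lemma step_bound {n : ℕ} (p : ℕ → ℝ) (h : Hist n) {m : ℝ} (hm : 1 < m)
    (hp : p (h.length + 1) = 1 / m) (hr : (pendCount h : ℝ) ≤ m) :
    ∑ v, stepProb (fun _ : Fin n => ageProtocol p) h v * (pendCount (h ++ [v]) : ℝ)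
      ≤ (1 - 1 / (Real.exp 1 * m)) * pendCount h := by
  simp_rw [pendCount_append, mul_sub, Finset.mul_sum]
  rw [Finset.sum_sub_distrib, ← Finset.sum_mul, stepProb_sum, Finset.sum_comm]
  have : ∑ i with pending h i, 1 / (Real.exp 1 * m) ≤
      ∑ i with pending h i, ∑ v, stepProb (fun _ : Fin n => ageProtocol p) h v *
        (if alone v i then (1 : ℝ) else 0) := by
    refine Finset.sum_le_sum fun i hi => ?_
    rw [sum_alone, stepProb_single p h i (by simpa using hi), hp]
    refine success_bound hm _ ?_ hr
    exact Finset.card_pos.mpr ⟨i, hi⟩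
  rw [Finset.sum_const, nsmul_eq_mul] at this
  have e : ((Finset.univ.filter fun i : Fin n => pending h i).card : ℝ) = pendCount h := rfl
  rw [e] at this
  linarith

lemma main_induction {n : ℕ} (p : ℕ → ℝ) {m : ℝ} (hm : 1 < m) (s : ℕ) : ∀ h : Hist n,
    (∀ t, h.length < t → t ≤ h.length + s → p t = 1 / m) → (pendCount h : ℝ) ≤ m →
    1 - (1 - 1 / (Real.exp 1 * m)) ^ s * pendCount h ≤
      condEvProb (fun _ : Fin n => ageProtocol p) h s (fun h' => ∀ i : Fin n, ¬ pending h' i) := by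
  have hc : 0 ≤ 1 - 1 / (Real.exp 1 * m) := by
    have : (1 : ℝ) ≤ Real.exp 1 := Real.one_le_exp (by norm_num)
    have : 1 ≤ Real.exp 1 * m := by nlinarith
    have : 1 / (Real.exp 1 * m) ≤ 1 := by
      rw [div_le_one (by linarith)]; exact this
    linarith
  induction s with
  | zero =>
    intro h _ _
    by_cases hq : ∀ i : Fin n, ¬ pending h i
    · simp [condEvProb, hq, contProb]
    · have : 1 ≤ pendCount h := by
        push Not at hq
        obtain ⟨i, hi⟩ := hq
        exact Finset.card_pos.mpr ⟨i, by simpa using hi⟩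
      have : (1 : ℝ) ≤ pendCount h := by exact_mod_cast this
      simp [condEvProb, hq]
      exact_mod_cast this
  | succ s ih =>
    intro h hp hr
    have hp1 : p (h.length + 1) = 1 / m := hp _ (by omega) (by omega)
    have h1m : 1 / m ≤ 1 := by rw [div_le_one (by linarith)]; linarith
    have h0m : 0 ≤ 1 / m := by positivity
    rw [condEvProb_succ]
    have hs := step_bound p h hm hp1 hr
    calc 1 - (1 - 1 / (Real.exp 1 * m)) ^ (s + 1) * pendCount h
        ≤ 1 - (1 - 1 / (Real.exp 1 * m)) ^ s *
          ∑ v, stepProb (fun _ : Fin n => ageProtocol p) h v * (pendCount (h ++ [v]) : ℝ) := by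
          have := mul_le_mul_of_nonneg_left hs (pow_nonneg hc s)
          rw [pow_succ, mul_assoc]
          linarith
      _ = ∑ v, stepProb (fun _ : Fin n => ageProtocol p) h v *
          (1 - (1 - 1 / (Real.exp 1 * m)) ^ s * pendCount (h ++ [v])) := by
          simp_rw [mul_sub, mul_one]
          rw [Finset.sum_sub_distrib, stepProb_sum, Finset.mul_sum]
          congr 1
          refine Finset.sum_congr rfl fun v _ => by ring
      _ ≤ _ := by
          refine Finset.sum_le_sum fun v _ => ?_
          refine mul_le_mul_of_nonneg_left ?_
            (stepProb_nonneg p h v (by rw [hp1]; exact h0m) (by rw [hp1]; exact h1m))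
          apply ih
          · intro t h1 h2
            simp only [List.length_append, List.length_singleton] at h1 h2
            exact hp t (by omega) (by omega)
          · exact le_trans (by exact_mod_cast pendCount_append_le h v) hr

lemma final_bound : ∃ M : ℝ, ∀ m : ℝ, M ≤ m → 1 < m ∧ ∀ n : ℕ, m ^ 2 ≤ n →
    (1 - 1 / (Real.exp 1 * m)) ^ n * m ≤ Real.exp (-m / 3) := by
  have he := Real.exp_one_lt_d9
  have he0 := Real.exp_pos 1
  have hd : 0 < 1 / Real.exp 1 - 1 / 3 := by
    have : 1 / 3 < 1 / Real.exp 1 := one_div_lt_one_div_of_lt he0 (by linarith)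
    linarith
  have hl := Real.isLittleO_log_id_atTop.def hd
  obtain ⟨M, hM⟩ := Filter.eventually_atTop.mp hl
  refine ⟨max M 2, fun m hm => ?_⟩
  have hm2 : 2 ≤ m := le_trans (le_max_right _ _) hm
  have hlog := hM m (le_trans (le_max_left _ _) hm)
  have hm0 : 0 < m := by linarith
  refine ⟨by linarith, fun n hn => ?_⟩
  have hlog' : Real.log m ≤ (1 / Real.exp 1 - 1 / 3) * m := by
    have := le_trans (le_abs_self _) hlog
    simpa [abs_of_pos hm0] using this
  have hc : 0 ≤ 1 - 1 / (Real.exp 1 * m) := by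
    have : (1 : ℝ) ≤ Real.exp 1 := Real.one_le_exp (by norm_num)
    have : 1 ≤ Real.exp 1 * m := by nlinarith
    have : 1 / (Real.exp 1 * m) ≤ 1 := by
      rw [div_le_one (by linarith)]; exact this
    linarith
  calc (1 - 1 / (Real.exp 1 * m)) ^ n * m
      ≤ (Real.exp (-(1 / (Real.exp 1 * m)))) ^ n * Real.exp (Real.log m) := by
        rw [Real.exp_log hm0]
        gcongr
        linarith [Real.add_one_le_exp (-(1 / (Real.exp 1 * m)))]
    _ = Real.exp (n * (-(1 / (Real.exp 1 * m))) + Real.log m) := by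
        rw [Real.exp_add, Real.exp_nat_mul]
    _ ≤ Real.exp (-m / 3) := by
        apply Real.exp_le_exp.mpr
        have : m ^ 2 * (1 / (Real.exp 1 * m)) ≤ n * (1 / (Real.exp 1 * m)) := by gcongr
        have e : m ^ 2 * (1 / (Real.exp 1 * m)) = 1 / Real.exp 1 * m := by field_simp
        rw [e] at this
        linarith

/-- Suppose all `n` players use protocol `Q` (for all sufficiently large
`n`).  Conditionally on any positive-probability joint history `h` reaching the start of
the last interval `I_{k+1}` with at most `n_{k+1}` pending players, the probability that
every player has successfully transmitted by the end of `I_{k+1}` is at least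
`1 − exp(−n_{k+1}/3)`. -/
theorem last_interval_lemma :
    ∀ β : ℝ, 0 < β → β < 1 →
      ∃ n₀ : ℕ, ∀ n : ℕ, n₀ ≤ n →
        ∀ k : ℕ, β ^ (k + 1) * n ≤ Real.sqrt n → Real.sqrt n < β ^ k * n →
          ∀ p : ℕ → ℝ, QSpec β n k p →
            ∀ h : Hist n, h.length = cumLen β n k k →
              0 < histProb (fun _ : Fin n => ageProtocol p) h →
              (pendCount h : ℝ) ≤ nj β n (k + 1) →
              1 - Real.exp (-(nj β n (k + 1)) / 3) ≤
                condEvProb (fun _ : Fin n => ageProtocol p) h (intervalLen β n k (k + 1))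
                  (fun h' => ∀ i : Fin n, ¬ pending h' i) := by
  intro β hβ0 hβ1
  obtain ⟨M, hM⟩ := final_bound
  refine ⟨⌈(M / β) ^ 2⌉₊, fun n hn k hk1 hk2 p hQ h hlen _ hr => ?_⟩
  have hn' : (M / β) ^ 2 ≤ n := Nat.ceil_le.mp hn
  have hMs : M / β ≤ Real.sqrt n := Real.le_sqrt_of_sq_le hn'
  have hMm : M ≤ nj β n (k + 1) := by
    rw [div_le_iff₀ hβ0] at hMs
    unfold nj
    rw [pow_succ]
    nlinarith
  obtain ⟨hm1, hfin⟩ := hM _ hMm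
  have hsq : (nj β n (k + 1)) ^ 2 ≤ n := by
    have h1 : nj β n (k + 1) ≤ Real.sqrt n := hk1
    calc (nj β n (k + 1)) ^ 2 ≤ (Real.sqrt n) ^ 2 := by gcongr
      _ = (n : ℝ) := Real.sq_sqrt (Nat.cast_nonneg n)
  have hint : intervalLen β n k (k + 1) = n := by simp [intervalLen]
  have hcum : cumLen β n k (k + 1) = cumLen β n k k + n := by
    unfold cumLen
    rw [Finset.sum_Icc_succ_top (by omega), hint]
  rw [hint]
  refine le_trans ?_ (main_induction p hm1 n h ?_ hr)
  · have h1 := hfin n hsq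
    have hc : 0 ≤ 1 - 1 / (Real.exp 1 * nj β n (k + 1)) := by
      have : (1 : ℝ) ≤ Real.exp 1 := Real.one_le_exp (by norm_num)
      have : 1 ≤ Real.exp 1 * nj β n (k + 1) := by nlinarith
      have : 1 / (Real.exp 1 * nj β n (k + 1)) ≤ 1 := by
        rw [div_le_one (by linarith)]; exact this
      linarith
    have h2 := mul_le_mul_of_nonneg_left hr (pow_nonneg hc n)
    linarith
  · intro t h1 h2
    refine hQ.1 (k + 1) (by omega) le_rfl t ?_ ?_
    · simpa [hlen] using h1
    · rw [hcum]; omega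

end Contention
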